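/- For every integer n, the explicitly defined Laurent polynomial E_n satisfies the eigenvalue equation Y(E_n) = q^{-n/2}·t^{-1/2}·E_n if n > 0 and Y(E_n) = q^{-n/2}·t^{1/2}·E_n if n ≤ 0; in other words, the explicit formulas give the nonsymmetric Macdonald polynomials of type A₁ (eigenfunctions of the Dunkl-type operator Y with eigenvalue q^{-n_#}, where n_# = (n+k)/2 for n>0 and (n-k)/2 for n≤0 with t = q^k). -/

import Mathlib

/-!
Nonsymmetric Macdonald polynomials of type A₁: the explicit Laurent polynomials `E n`
are eigenfunctions of the Dunkl-type operator `Y` with eigenvalue `q^{-n_#}`.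

The ground field is `F = ℚ(u,v)` with `q = u⁴`, `t = v²`; the Laurent polynomials
`F[X, X⁻¹]` are regarded inside the ambient field `M = F(X)`, in which all operators
are given by the same formulas (division by `X² - 1` is then unproblematic).
-/

noncomputable section

/-- The ground field `ℚ(u,v)`. -/
abbrev F : Type := RatFunc (RatFunc ℚ)

/-- `u`, with `q = u⁴` (so `u = q^{1/4}`). -/
def u : F := RatFunc.C RatFunc.X

/-- `v`, with `t = v²` (so `v = t^{1/2}`). -/
def v : F := RatFunc.X

/-- `q = u⁴`. -/
def q : F := u ^ 4

/-- `t = v²`. -/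
def t : F := v ^ 2

/-- The ambient field `F(X)` containing the Laurent polynomials `F[X,X⁻¹]`. -/
abbrev M : Type := RatFunc F

/-- The variable `X`. -/
def XM : M := RatFunc.X

/-- The involution `s : Xⁿ ↦ X⁻ⁿ` (the substitution `X ↦ X⁻¹`). -/
def sOp : M → M := RatFunc.eval RatFunc.C (XM⁻¹)

/-- The operator `π : Xⁿ ↦ q^{n/2} X⁻ⁿ` (the substitution `X ↦ q^{1/2} X⁻¹`). -/
def piOp : M → M := RatFunc.eval RatFunc.C (RatFunc.C (u ^ 2) * XM⁻¹)

/-- The Demazure-Lusztig operator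
`T(f) = t^{1/2}·s(f) + (t^{1/2} - t^{-1/2})·(s(f) - f)/(X² - 1)`. -/
def TOp (f : M) : M :=
  RatFunc.C v * sOp f + RatFunc.C (v - v⁻¹) * (sOp f - f) / (XM ^ 2 - 1)

/-- The operator `Y = π ∘ T`. -/
def YOp (f : M) : M := piOp (TOp f)

/-- The product `∏_{i=0}^{j-1} [(1-q^{n-i-1})(1-t qⁱ)]/[(1-q^{1+i})(1-t q^{n-i-1})]`. -/
def macProdPos (n j : ℕ) : F :=
  ∏ i ∈ Finset.range j,
    ((1 - q ^ ((n : ℤ) - i - 1)) * (1 - t * q ^ (i : ℤ))) /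
      ((1 - q ^ ((i : ℤ) + 1)) * (1 - t * q ^ ((n : ℤ) - i - 1)))

/-- The product `∏_{i=0}^{j-1} [(1-q^{n-i})(1-t qⁱ)]/[(1-q^{1+i})(1-t q^{n-i})]`. -/
def macProdNeg (n j : ℕ) : F :=
  ∏ i ∈ Finset.range j,
    ((1 - q ^ ((n : ℤ) - i)) * (1 - t * q ^ (i : ℤ))) /
      ((1 - q ^ ((i : ℤ) + 1)) * (1 - t * q ^ ((n : ℤ) - i)))

/-- `E_n` for `n ≥ 1`. -/
def Epos (n : ℕ) : M :=
  XM ^ (n : ℤ)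
    + ∑ j ∈ Finset.Icc 1 (n / 2),
        RatFunc.C (q ^ ((n : ℤ) - j) * (1 - q ^ (j : ℤ)) / (1 - q ^ ((n : ℤ) - j)) *
          macProdPos n j) * XM ^ (2 * (j : ℤ) - n)
    + ∑ j ∈ Finset.Icc 1 ((n - 1) / 2),
        RatFunc.C (q ^ (j : ℤ) * macProdPos n j) * XM ^ ((n : ℤ) - 2 * j)

/-- `E_{-n}` for `n ≥ 1`. -/
def Eneg (n : ℕ) : M :=
  XM ^ (-(n : ℤ))
    + RatFunc.C ((1 - t) / (1 - t * q ^ (n : ℤ))) * XM ^ (n : ℤ)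
    + ∑ j ∈ Finset.Icc 1 (n / 2),
        RatFunc.C (macProdNeg n j) * XM ^ (2 * (j : ℤ) - n)
    + ∑ j ∈ Finset.Icc 1 ((n - 1) / 2),
        RatFunc.C ((1 - t * q ^ (j : ℤ)) / (1 - t * q ^ ((n : ℤ) - j)) * macProdNeg n j) *
          XM ^ ((n : ℤ) - 2 * j)

/-- The nonsymmetric Macdonald polynomials `E_n`, `n ∈ ℤ`, given by the explicit formulas. -/
def E : ℤ → M := fun n => if 0 < n then Epos n.toNat else if n = 0 then 1 else Eneg (-n).toNat

section helpers
set_option maxSynthPendingDepth 6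

lemma XM_ne_C (c : F) : XM ≠ RatFunc.C c := by
  intro h
  apply RatFunc.transcendental_X (K := F)
  have h' : (RatFunc.X : M) = algebraMap F M c := by
    rw [← RatFunc.algebraMap_eq_C] at h; exact h
  rw [h']
  exact isAlgebraic_algebraMap c

lemma XM_ne_zero : XM ≠ 0 := by
  intro h; apply XM_ne_C 0; simpa using h

lemma u_ne_zero : u ≠ 0 := by
  unfold u
  simp [RatFunc.X_ne_zero]

lemma v_ne_zero : v ≠ 0 := RatFunc.X_ne_zero

lemma q_ne_zero : q ≠ 0 := pow_ne_zero _ u_ne_zero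

lemma eval₂_ne_zero_of (y : M) (hy : ∀ c, y ≠ RatFunc.C c) (p : Polynomial F) (hp : p ≠ 0) :
    Polynomial.eval₂ (RatFunc.C : F →+* M) y p ≠ 0 := by
  intro h
  have ht : Transcendental F y := RatFunc.transcendental_of_ne_C y (by rintro ⟨c, hc⟩; exact hy c hc)
  apply ht
  refine ⟨p, hp, ?_⟩
  rw [Polynomial.aeval_def, RatFunc.algebraMap_eq_C]; exact h

/-- Evaluation at a nonconstant element, as a ring homomorphism. -/
def evHom (y : M) (hy : ∀ c, y ≠ RatFunc.C c) : M →+* M where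
  toFun := RatFunc.eval RatFunc.C y
  map_zero' := RatFunc.eval_zero _ _
  map_one' := RatFunc.eval_one _ _
  map_add' a b := RatFunc.eval_add _ _ (eval₂_ne_zero_of y hy _ (RatFunc.denom_ne_zero a))
    (eval₂_ne_zero_of y hy _ (RatFunc.denom_ne_zero b))
  map_mul' a b := RatFunc.eval_mul _ _ (eval₂_ne_zero_of y hy _ (RatFunc.denom_ne_zero a))
    (eval₂_ne_zero_of y hy _ (RatFunc.denom_ne_zero b))

lemma hs (c : F) : XM⁻¹ ≠ RatFunc.C c := by
  intro h
  apply XM_ne_C c⁻¹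
  rw [map_inv₀, ← h, inv_inv]

lemma hpi (c : F) : RatFunc.C (u ^ 2) * XM⁻¹ ≠ RatFunc.C c := by
  intro h
  apply hs ((u ^ 2)⁻¹ * c)
  have h2 : (RatFunc.C (u ^ 2) : M) ≠ 0 := by
    rw [map_ne_zero]; exact pow_ne_zero _ u_ne_zero
  rw [map_mul, ← h, map_inv₀, inv_mul_cancel_left₀ h2]

lemma sOp_term (n : ℕ) (S : Finset ℕ) (a : ℕ → F) (e : ℕ → ℤ) :
    sOp (∑ j ∈ S, RatFunc.C (a j) * XM ^ (e j)) = ∑ j ∈ S, RatFunc.C (a j) * XM ^ (- e j) := by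
  have h : sOp = evHom XM⁻¹ hs := rfl
  have hC : ∀ c, evHom XM⁻¹ hs (RatFunc.C c) = RatFunc.C c := fun c => RatFunc.eval_C _ _
  have hX : evHom XM⁻¹ hs XM = XM⁻¹ := RatFunc.eval_X _ _
  rw [h, map_sum]
  simp only [map_mul, map_zpow₀, hC, hX, inv_zpow', zpow_neg]

lemma piOp_term (lam : F) (S : Finset ℕ) (a : ℕ → F) (e : ℕ → ℤ) :
    piOp (RatFunc.C lam * ∑ j ∈ S, RatFunc.C (a j * (u ^ 2) ^ (e j)) * XM ^ (- e j)) =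
      RatFunc.C lam * ∑ j ∈ S, RatFunc.C (a j) * XM ^ (e j) := by
  have h : piOp = evHom (RatFunc.C (u ^ 2) * XM⁻¹) hpi := rfl
  have hC : ∀ c, evHom (RatFunc.C (u ^ 2) * XM⁻¹) hpi (RatFunc.C c) = RatFunc.C c :=
    fun c => RatFunc.eval_C _ _
  have hX : evHom (RatFunc.C (u ^ 2) * XM⁻¹) hpi XM = RatFunc.C (u ^ 2) * XM⁻¹ := RatFunc.eval_X _ _
  have h2 : (RatFunc.C (u ^ 2) : M) ≠ 0 := by
    rw [map_ne_zero]; exact pow_ne_zero _ u_ne_zero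
  rw [h, map_mul, map_sum, hC]
  congr 1
  apply Finset.sum_congr rfl
  intro j _
  rw [map_mul, map_zpow₀, hC, hX, map_mul, map_zpow₀, mul_zpow, inv_zpow', neg_neg, mul_assoc,
    ← mul_assoc (_ ^ e j), ← zpow_add₀ h2]
  simp

lemma telescope (b d : ℕ → F) (n : ℕ) (h0 : b 0 = d 0)
    (hstep : ∀ j < n, b (j + 1) = b j + d (j + 1)) :
    ∑ j ∈ Finset.range (n + 1), ((XM ^ 2 - 1) * RatFunc.C (b j) + RatFunc.C (d j)) * XM ^ (2 * j) =
      RatFunc.C (b n) * XM ^ (2 * n + 2) := by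
  induction n with
  | zero => simp [h0]; ring
  | succ n ih =>
    rw [Finset.sum_range_succ, ih (fun j hj => hstep j (by omega)), hstep n (by omega), map_add]
    ring

lemma XM_sq_ne : XM ^ 2 - 1 ≠ 0 := by
  intro h
  have h1 : (XM - 1) * (XM + 1) = 0 := by linear_combination h
  rcases mul_eq_zero.1 h1 with h | h
  · apply XM_ne_C 1; rw [map_one]; linear_combination h
  · apply XM_ne_C (-1); rw [map_neg, map_one]; linear_combination h

lemma eigen (n : ℕ) (a : ℕ → F) (lam : F) (b : ℕ → F)
    (hb : ∀ j ≤ n, b j = a j * (v - lam * (u ^ 2) ^ ((n : ℤ) - 2 * j)))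
    (h0 : b 0 = (v - v⁻¹) * (a n - a 0) * (-1))
    (hstep : ∀ j < n, b (j + 1) = b j + (v - v⁻¹) * (a (j + 1) - a (n - (j + 1))))
    (hn : b n = 0) :
    YOp (∑ j ∈ Finset.range (n + 1), RatFunc.C (a j) * XM ^ ((n : ℤ) - 2 * j)) =
      RatFunc.C lam * ∑ j ∈ Finset.range (n + 1), RatFunc.C (a j) * XM ^ ((n : ℤ) - 2 * j) := by
  rw [← piOp_term, YOp]
  congr 1
  rw [TOp, sOp_term n]
  have hrefl : ∑ j ∈ Finset.range (n + 1), RatFunc.C (a j) * XM ^ ((n : ℤ) - 2 * j) =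
      ∑ j ∈ Finset.range (n + 1), RatFunc.C (a (n - j)) * XM ^ (-((n : ℤ) - 2 * j)) := by
    rw [← Finset.sum_range_reflect]
    apply Finset.sum_congr rfl
    intro j hj
    have hj' : j ≤ n := by simpa [Nat.lt_succ_iff] using hj
    have : n + 1 - 1 - j = n - j := by omega
    rw [this]
    congr 2
    push_cast [hj']
    ring
  have key := telescope b (fun j => (v - v⁻¹) * (a j - a (n - j))) n
    (by rw [h0]; simp; ring) hstep
  rw [hn, map_zero, zero_mul] at key
  have hX : XM ^ 2 - 1 ≠ 0 := XM_sq_ne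
  rw [hrefl]
  have key2 : (XM ^ 2 - 1) * (RatFunc.C v * ∑ j ∈ Finset.range (n + 1), RatFunc.C (a j) * XM ^ (-((n : ℤ) - 2 * j))
      - RatFunc.C lam * ∑ j ∈ Finset.range (n + 1), RatFunc.C (a j * (u ^ 2) ^ ((n : ℤ) - 2 * j)) * XM ^ (-((n : ℤ) - 2 * j)))
      + RatFunc.C (v - v⁻¹) * (∑ j ∈ Finset.range (n + 1), RatFunc.C (a j) * XM ^ (-((n : ℤ) - 2 * j))
      - ∑ j ∈ Finset.range (n + 1), RatFunc.C (a (n - j)) * XM ^ (-((n : ℤ) - 2 * j))) = 0 := by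
    rw [← mul_zero (XM ^ (-(n : ℤ))), ← key]
    simp only [Finset.mul_sum, ← Finset.sum_sub_distrib, ← Finset.sum_add_distrib]
    apply Finset.sum_congr rfl
    intro j hj
    have hj' : j ≤ n := by simpa [Nat.lt_succ_iff] using hj
    have hx : XM ^ (-((n : ℤ) - 2 * j)) = XM ^ (-(n : ℤ)) * XM ^ (2 * j) := by
      rw [← zpow_natCast, ← zpow_add₀ XM_ne_zero]
      congr 1
      push_cast; ring
    rw [hx, hb j hj']
    simp only [map_mul, map_sub]
    ring
  generalize RatFunc.C (v - v⁻¹) = w at key2 ⊢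
  rw [mul_div_assoc, eq_comm, ← sub_eq_zero]
  field_simp
  linear_combination -key2

lemma sum_split (f : ℕ → M) (n : ℕ) (hn : 1 ≤ n) :
    ∑ j ∈ Finset.range (n + 1), f j = f 0 + f n + ∑ j ∈ Finset.Icc 1 (n / 2), f (n - j)
      + ∑ j ∈ Finset.Icc 1 ((n - 1) / 2), f j := by
  have h1 : ∑ j ∈ Finset.Icc 1 (n / 2), f (n - j) = ∑ j ∈ Finset.Ico ((n - 1) / 2 + 1) n, f j := by
    apply Finset.sum_bij' (fun j _ => n - j) (fun j _ => n - j)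
    · intro j hj; simp only [Finset.mem_Icc, Finset.mem_Ico] at *; omega
    · intro j hj; simp only [Finset.mem_Icc, Finset.mem_Ico] at *; omega
    · intro j hj; simp only [Finset.mem_Icc, Finset.mem_Ico] at *; omega
    · intro j hj; simp only [Finset.mem_Icc, Finset.mem_Ico] at *; omega
    · intro j hj; rfl
  have h2 : Finset.Icc 1 ((n - 1) / 2) = Finset.Ico 1 ((n - 1) / 2 + 1) := by
    ext j; simp only [Finset.mem_Icc, Finset.mem_Ico]; omega
  rw [h1, h2, Finset.sum_range_succ, Finset.range_eq_Ico, Finset.sum_eq_sum_Ico_succ_bot (by omega),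
    ← Finset.sum_Ico_consecutive f (show 0 + 1 ≤ (n - 1) / 2 + 1 by omega)
      (show (n - 1) / 2 + 1 ≤ n by omega)]
  simp only [zero_add]
  ring

lemma one_sub_q (k : ℕ) : 1 - q ^ (k + 1) ≠ 0 := by
  intro h
  have h1 : (RatFunc.X : RatFunc ℚ) ^ (4 * (k + 1)) = 1 := by
    apply (RatFunc.C : RatFunc ℚ →+* F).injective
    rw [map_pow, map_one]
    have : u ^ (4 * (k + 1)) = 1 := by
      rw [pow_mul]; exact (sub_eq_zero.1 h).symm
    exact this
  have h2 := congrArg RatFunc.num h1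
  rw [← RatFunc.algebraMap_X, ← map_pow, RatFunc.num_algebraMap, RatFunc.num_one] at h2
  have h3 := congrArg Polynomial.natDegree h2
  simp at h3

lemma one_sub_tq (k : ℕ) : 1 - t * q ^ k ≠ 0 := by
  intro h
  apply RatFunc.transcendental_X (K := RatFunc ℚ)
  apply IsAlgebraic.of_pow (n := 2) (by omega)
  have h2 : (RatFunc.X : F) ^ 2 = algebraMap (RatFunc ℚ) F ((RatFunc.X ^ (4 * k))⁻¹) := by
    rw [RatFunc.algebraMap_eq_C, map_inv₀, map_pow]
    have h3 : v ^ 2 * u ^ (4 * k) = 1 := by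
      rw [pow_mul]; exact (sub_eq_zero.1 h).symm
    exact eq_inv_of_mul_eq_one_left h3
  rw [h2]
  exact isAlgebraic_algebraMap _

/-- `(q;q)_k`. -/
def pA (k : ℕ) : F := ∏ i ∈ Finset.range k, (1 - q ^ (i + 1))
/-- `(t;q)_k`. -/
def pB (k : ℕ) : F := ∏ i ∈ Finset.range k, (1 - t * q ^ i)

lemma pA_succ (k : ℕ) : pA (k + 1) = pA k * (1 - q ^ (k + 1)) := Finset.prod_range_succ _ _
lemma pB_succ (k : ℕ) : pB (k + 1) = pB k * (1 - t * q ^ k) := Finset.prod_range_succ _ _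
lemma pA_ne (k : ℕ) : pA k ≠ 0 := Finset.prod_ne_zero_iff.2 fun i _ => one_sub_q i
lemma pB_ne (k : ℕ) : pB k ≠ 0 := Finset.prod_ne_zero_iff.2 fun i _ => one_sub_tq i

lemma macPos_closed (j k : ℕ) (h : 1 ≤ j + k) : macProdPos (j + k) j =
    pA (j + k) / (pB (j + k) * (1 - q ^ (j + k))) * (pB j * pB k * (1 - q ^ k) / (pA j * pA k)) := by
  induction j generalizing k with
  | zero =>
    obtain ⟨k, rfl⟩ : ∃ m, k = m + 1 := ⟨k - 1, by omega⟩
    have := pA_ne (k + 1)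
    have := pB_ne (k + 1)
    have := one_sub_q k
    simp only [macProdPos, zero_add, Finset.range_zero, Finset.prod_empty]
    have hA : pA 0 = 1 := rfl
    have hB : pB 0 = 1 := rfl
    rw [hA, hB]
    field_simp
  | succ j ih =>
    have h1 := ih (k + 1) (by omega)
    have e : j + 1 + k = j + (k + 1) := by omega
    have e2 : ((j + (k + 1) : ℕ) : ℤ) - (j : ℤ) - 1 = (k : ℕ) := by push_cast; ring
    have e3 : ((j : ℤ) + 1) = ((j + 1 : ℕ) : ℤ) := by push_cast; ring
    rw [e]
    rw [macProdPos] at h1 ⊢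
    rw [Finset.prod_range_succ, h1, e2, e3, pA_succ j, pB_succ j, pA_succ k, pB_succ k]
    simp only [zpow_natCast]
    have := pA_ne j
    have := pA_ne k
    have := pB_ne (j + (k + 1))
    have := one_sub_q (j + k)
    have := one_sub_q j
    have := one_sub_q k
    have := one_sub_tq k
    rw [show j + (k + 1) = j + k + 1 from rfl] at *
    field_simp

lemma macNeg_closed (j k : ℕ) : macProdNeg (j + k) j =
    pA (j + k) / pB (j + k + 1) * (pB j * pB (k + 1) / (pA j * pA k)) := by
  induction j generalizing k with
  | zero =>
    have := pA_ne k
    have := pB_ne (k + 1)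
    simp only [macProdNeg, zero_add, Finset.range_zero, Finset.prod_empty]
    have hA : pA 0 = 1 := rfl
    have hB : pB 0 = 1 := rfl
    rw [hA, hB]
    field_simp
  | succ j ih =>
    have h1 := ih (k + 1)
    have e : j + 1 + k = j + (k + 1) := by omega
    have e2 : ((j + (k + 1) : ℕ) : ℤ) - (j : ℤ) = (k + 1 : ℕ) := by push_cast; ring
    have e3 : ((j : ℤ) + 1) = ((j + 1 : ℕ) : ℤ) := by push_cast; ring
    rw [e]
    rw [macProdNeg] at h1 ⊢
    rw [Finset.prod_range_succ, h1, e2, e3, pA_succ j, pB_succ j, pA_succ k, pB_succ (k + 1)]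
    simp only [zpow_natCast]
    have := pA_ne j
    have := pA_ne k
    have := pB_ne (j + (k + 1) + 1)
    have := one_sub_q j
    have := one_sub_q k
    have := one_sub_tq (k + 1)
    field_simp

/-- coefficients of `E_n` at `X^{n-2j}`, `n>0`. -/
def aPos (n j : ℕ) : F :=
  pA n / (pB n * (1 - q ^ n)) * (q ^ j * (pB j * pB (n - j) * (1 - q ^ (n - j)) / (pA j * pA (n - j))))

/-- coefficients of `E_{-n}` at `X^{n-2j}`. -/
def aNeg (n j : ℕ) : F :=
  pA n / pB (n + 1) * (pB (j + 1) * pB (n - j) / (pA j * pA (n - j)))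

lemma aPos_zero (n : ℕ) (hn : 1 ≤ n) : aPos n 0 = 1 := by
  have h := macPos_closed 0 n (by omega)
  simp only [zero_add] at h
  have h1 : macProdPos n 0 = 1 := by simp [macProdPos]
  rw [h1] at h
  rw [aPos, pow_zero, one_mul, Nat.sub_zero, ← h]

lemma aPos_top (n : ℕ) : aPos n n = 0 := by simp [aPos]

lemma Epos_eq (n : ℕ) (hn : 1 ≤ n) :
    Epos n = ∑ j ∈ Finset.range (n + 1), RatFunc.C (aPos n j) * XM ^ ((n : ℤ) - 2 * j) := by
  rw [sum_split _ n hn, Epos, aPos_zero n hn, aPos_top]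
  congr 1
  · congr 1
    · simp
    · apply Finset.sum_congr rfl
      intro j hj
      obtain ⟨hj1, hj2⟩ := Finset.mem_Icc.1 hj
      obtain ⟨k, rfl⟩ : ∃ k, n = j + (k + 1) := ⟨n - j - 1, by omega⟩
      congr 2
      · rw [macPos_closed j (k + 1) (by omega), aPos]
        have e1 : j + (k + 1) - j = k + 1 := by omega
        have e2 : j + (k + 1) - (k + 1) = j := by omega
        have e3 : ((j + (k + 1) : ℕ) : ℤ) - (j : ℤ) = (k + 1 : ℕ) := by push_cast; ring
        rw [e1, e2, e3]
        simp only [zpow_natCast]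
        have := one_sub_q k
        have := one_sub_q (j + k)
        have := pA_ne j
        have := pA_ne (k + 1)
        have := pB_ne (j + (k + 1))
        rw [show j + (k + 1) = j + k + 1 from rfl] at *
        field_simp
      · push_cast [show j ≤ j + (k + 1) by omega]
        ring
  · apply Finset.sum_congr rfl
    intro j hj
    obtain ⟨hj1, hj2⟩ := Finset.mem_Icc.1 hj
    obtain ⟨k, rfl⟩ : ∃ k, n = j + (k + 1) := ⟨n - j - 1, by omega⟩
    congr 2
    rw [macPos_closed j (k + 1) (by omega), aPos]
    have e1 : j + (k + 1) - j = k + 1 := by omega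
    rw [e1]
    simp only [zpow_natCast]
    ring

lemma aNeg_top (n : ℕ) : aNeg n n = 1 := by
  have hA : pA 0 = 1 := rfl
  have hB : pB 0 = 1 := rfl
  have := pA_ne n
  have := pB_ne (n + 1)
  rw [aNeg, Nat.sub_self, hA, hB]
  field_simp

lemma aNeg_zero (n : ℕ) : aNeg n 0 = (1 - t) / (1 - t * q ^ n) := by
  have hA : pA 0 = 1 := rfl
  have hB : pB 1 = 1 - t := by simp [pB]
  have := pA_ne n
  have := pB_ne n
  have := one_sub_tq n
  rw [aNeg, Nat.sub_zero, hA, zero_add, hB, pB_succ]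
  field_simp

lemma Eneg_eq (n : ℕ) (hn : 1 ≤ n) :
    Eneg n = ∑ j ∈ Finset.range (n + 1), RatFunc.C (aNeg n j) * XM ^ ((n : ℤ) - 2 * j) := by
  rw [sum_split _ n hn, Eneg, aNeg_zero, aNeg_top]
  congr 1
  · congr 1
    · rw [add_comm]
      simp only [zpow_natCast]
      congr 1
      rw [map_one, one_mul]; congr 1; ring
    · apply Finset.sum_congr rfl
      intro j hj
      obtain ⟨hj1, hj2⟩ := Finset.mem_Icc.1 hj
      obtain ⟨k, rfl⟩ : ∃ k, n = j + k := ⟨n - j, by omega⟩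
      congr 2
      · rw [macNeg_closed j k, aNeg]
        have e1 : j + k - j = k := by omega
        have e2 : j + k - k = j := by omega
        rw [e1, e2]
        ring
      · push_cast [show j ≤ j + k by omega]
        ring
  · apply Finset.sum_congr rfl
    intro j hj
    obtain ⟨hj1, hj2⟩ := Finset.mem_Icc.1 hj
    obtain ⟨k, rfl⟩ : ∃ k, n = j + k := ⟨n - j, by omega⟩
    congr 2
    rw [macNeg_closed j k, aNeg]
    have e1 : j + k - j = k := by omega
    have e3 : ((j + k : ℕ) : ℤ) - (j : ℤ) = (k : ℕ) := by push_cast; ring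
    rw [e1, e3, pB_succ j, pB_succ k]
    simp only [zpow_natCast]
    have := one_sub_tq k
    have := pA_ne j
    have := pA_ne k
    have := pB_ne (j + k + 1)
    field_simp

lemma u_pow_pos (n j : ℕ) : (u ^ 2) ^ (-(n : ℤ)) * (u ^ 2) ^ ((n : ℤ) - 2 * j) = (q ^ j)⁻¹ := by
  have hu : u ^ 2 ≠ 0 := pow_ne_zero _ u_ne_zero
  rw [← zpow_add₀ hu, show -(n : ℤ) + ((n : ℤ) - 2 * j) = -((2 * j : ℕ) : ℤ) by push_cast; ring,
    zpow_neg, zpow_natCast, q]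
  congr 1
  ring

lemma u_pow_neg (k j : ℕ) :
    (u ^ 2) ^ ((j + k : ℕ) : ℤ) * (u ^ 2) ^ (((j + k : ℕ) : ℤ) - 2 * j) = q ^ k := by
  have hu : u ^ 2 ≠ 0 := pow_ne_zero _ u_ne_zero
  rw [← zpow_add₀ hu, show ((j + k : ℕ) : ℤ) + (((j + k : ℕ) : ℤ) - 2 * j) = ((2 * k : ℕ) : ℤ) by
    push_cast; ring, zpow_natCast, q]
  ring

lemma YEpos (n : ℕ) (hn : 1 ≤ n) :
    YOp (Epos n) = RatFunc.C ((u ^ 2) ^ (-(n : ℤ)) * v⁻¹) * Epos n := by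
  rw [Epos_eq n hn]
  have hv := v_ne_zero
  apply eigen n (aPos n) _ (fun j => aPos n j * (v - v⁻¹ * (q ^ j)⁻¹))
  · intro j _
    rw [← u_pow_pos n j]
    ring
  · simp [aPos_top]; ring
  · intro j hj
    obtain ⟨k, rfl⟩ : ∃ k, n = j + k + 1 := ⟨n - j - 1, by omega⟩
    have e1 : j + k + 1 - (j + 1) = k := by omega
    have e2 : j + k + 1 - j = k + 1 := by omega
    have e3 : j + k + 1 - k = j + 1 := by omega
    simp only [aPos, e1, e2, e3]
    generalize pA (j + k + 1) / (pB (j + k + 1) * (1 - q ^ (j + k + 1))) = K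
    rw [pA_succ, pA_succ, pB_succ, pB_succ]
    have h1 := one_sub_q k
    have h2 := one_sub_q j
    have h3 := pA_ne j
    have h4 := pA_ne k
    have h5 := q_ne_zero
    rw [pow_succ] at h1 h2
    have h1' := h1
    have h2' := h2
    rw [mul_comm] at h1' h2'
    rw [pow_succ, pow_succ]
    have h6 : q ^ j ≠ 0 := pow_ne_zero _ h5
    generalize q ^ j = x at *
    generalize q ^ k = y at *
    rw [t]
    field_simp
    ring
  · simp [aPos_top]

lemma YEneg_aux (n : ℕ) :
    YOp (∑ j ∈ Finset.range (n + 1), RatFunc.C (aNeg n j) * XM ^ ((n : ℤ) - 2 * j)) =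
    RatFunc.C ((u ^ 2) ^ (n : ℤ) * v) *
      ∑ j ∈ Finset.range (n + 1), RatFunc.C (aNeg n j) * XM ^ ((n : ℤ) - 2 * j) := by
  have hv := v_ne_zero
  apply eigen n (aNeg n) _ (fun j => aNeg n j * (v - v * q ^ (n - j)))
  · intro j hj
    obtain ⟨k, rfl⟩ : ∃ k, n = j + k := ⟨n - j, by omega⟩
    have e1 : j + k - j = k := by omega
    simp only [e1]
    rw [← u_pow_neg k j]
    ring
  · have := one_sub_tq n
    simp only [aNeg_top, aNeg_zero, Nat.sub_zero]
    rw [t] at *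
    field_simp
    ring
  · intro j hj
    obtain ⟨k, rfl⟩ : ∃ k, n = j + k + 1 := ⟨n - j - 1, by omega⟩
    have e1 : j + k + 1 - (j + 1) = k := by omega
    have e2 : j + k + 1 - j = k + 1 := by omega
    have e3 : j + k + 1 - k = j + 1 := by omega
    simp only [aNeg, e1, e2, e3]
    generalize pA (j + k + 1) / pB (j + k + 1 + 1) = K
    rw [pA_succ, pA_succ, pB_succ (j + 1), pB_succ j, pB_succ k]
    have h1 := one_sub_q k
    have h2 := one_sub_q j
    have h3 := pA_ne j
    have h4 := pA_ne k
    rw [pow_succ] at h1 h2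
    have h1' := h1
    have h2' := h2
    rw [mul_comm] at h1' h2'
    rw [pow_succ, pow_succ]
    generalize q ^ j = x at *
    generalize q ^ k = y at *
    rw [t]
    field_simp
    ring
  · simp

end helpers

/-- For every integer `n`, the explicit Laurent polynomial `E_n` satisfies
`Y(E_n) = q^{-n/2}·t^{-1/2}·E_n` for `n > 0` and `Y(E_n) = q^{-n/2}·t^{1/2}·E_n` for `n ≤ 0`,
i.e. `Y(E_n) = q^{-n_#} E_n`, where `n_# = (n+k)/2` for `n > 0` and `(n-k)/2` for `n ≤ 0`
(with `t = q^k`). -/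
theorem macdonald_eigenvalue_problem (n : ℤ) :
    YOp (E n) = RatFunc.C ((u ^ 2) ^ (-n) * (if 0 < n then v⁻¹ else v)) * E n := by
  rcases lt_trichotomy 0 n with h | h | h
  · obtain ⟨m, rfl⟩ : ∃ m : ℕ, n = m := ⟨n.toNat, by omega⟩
    simp only [E, h, if_true, Int.toNat_natCast]
    exact YEpos m (by omega)
  · subst h
    have h := YEneg_aux 0
    simpa [E, aNeg_top] using h
  · obtain ⟨m, rfl⟩ : ∃ m : ℕ, n = -(m : ℤ) := ⟨(-n).toNat, by omega⟩
    have h1 : ¬ (0 < -(m : ℤ)) := by omega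
    have h2 : ¬ (-(m : ℤ) = 0) := by omega
    simp only [E, h1, h2, if_false, neg_neg, Int.toNat_natCast]
    rw [Eneg_eq m (by omega)]
    exact YEneg_aux m
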